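/- Let 𝒫 be a prediction set and Φ : 𝒫⁺ → ℝ a sublinear function. Fix q ∈ 𝒫⁺ and suppose that 𝒪(q) has a trivial annihilator in ℒ(𝒫), i.e. the only f ∈ ℒ(𝒫) satisfying p·f = 0 for all p ∈ 𝒪(q) is f = 0 μ-almost everywhere. If there exists q* ∈ ℒ(𝒫) such that p·q* = Φ′₊(p,q) for all p ∈ 𝒫⁺, then q* is the unique 𝒫-integrable subgradient of Φ at q: q* is a 𝒫-integrable subgradient of Φ at q, and every 𝒫-integrable subgradient of Φ at q equals q* μ-almost everywhere. -/

import Mathlib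

set_option linter.unusedSectionVars false
open MeasureTheory Set Filter Topology

variable {Ω : Type*} [MeasurableSpace Ω]

/-- `P` is a prediction set with respect to `μ`: a convex set of probability
densities on `Ω`. -/
def IsPredictionSet (μ : Measure Ω) (P : Set (Ω → ℝ)) : Prop :=
  Convex ℝ P ∧ ∀ p ∈ P, Measurable p ∧ (∀ x, 0 ≤ p x) ∧
    Integrable p μ ∧ ∫ x, p x ∂μ = 1

/-- The prediction cone `𝒫⁺ = {λ p : λ > 0, p ∈ 𝒫}`. -/
def predCone (P : Set (Ω → ℝ)) : Set (Ω → ℝ) :=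
  {f | ∃ c : ℝ, 0 < c ∧ ∃ p ∈ P, f = c • p}

/-- `ℒ(𝒫)`: the `𝒫`-integrable functions. -/
def PIntegrable (μ : Measure Ω) (P : Set (Ω → ℝ)) (f : Ω → ℝ) : Prop :=
  Measurable f ∧ ∀ p ∈ P, Integrable (fun x => |f x| * p x) μ

/-- The pairing `p · f = ∫ f p dμ`. -/
noncomputable def pairing (μ : Measure Ω) (p f : Ω → ℝ) : ℝ :=
  ∫ x, f x * p x ∂μ

/-- `Φ` is (positively) 1-homogeneous and subadditive on the cone `cone`. -/
def SublinearOn (cone : Set (Ω → ℝ)) (Φ : (Ω → ℝ) → ℝ) : Prop :=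
  (∀ p ∈ cone, ∀ c : ℝ, 0 < c → Φ (c • p) = c * Φ p) ∧
  ∀ f ∈ cone, ∀ g ∈ cone, Φ (f + g) ≤ Φ f + Φ g

/-- `p` and `q` are positively collinear. -/
def PosCollinear (p q : Ω → ℝ) : Prop := ∃ c : ℝ, 0 < c ∧ p = c • q

/-- `𝒟(q)`: the set of directions from `q` into `𝒫⁺`. -/
def dirSet (P : Set (Ω → ℝ)) (q : Ω → ℝ) : Set (Ω → ℝ) :=
  {p | p ∈ Submodule.span ℝ P ∧ ∃ ε : ℝ, 0 < ε ∧ q + ε • p ∈ predCone P}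

/-- `𝒪(q) = 𝒟(q) ∩ (−𝒟(q))`. -/
def oSet (P : Set (Ω → ℝ)) (q : Ω → ℝ) : Set (Ω → ℝ) :=
  {p | p ∈ dirSet P q ∧ -p ∈ dirSet P q}

/-- The right directional derivative `Φ′₊(p,q)` of a sublinear `Φ` at `q` along `p`,
taken in `ℝ ∪ {−∞}` (for sublinear `Φ` the limit of slopes as `t → 0⁺` exists and
equals the infimum of the slopes, which is how it is expressed here). -/
noncomputable def rderiv (P : Set (Ω → ℝ)) (Φ : (Ω → ℝ) → ℝ) (q p : Ω → ℝ) : EReal :=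
  ⨅ t : {t : ℝ // 0 < t ∧ q + t • p ∈ predCone P},
    (((Φ (q + (t : ℝ) • p) - Φ q) / (t : ℝ) : ℝ) : EReal)

lemma predCone_subset_span (P : Set (Ω → ℝ)) :
    predCone P ⊆ (Submodule.span ℝ P : Set (Ω → ℝ)) := by
  rintro f ⟨c, hc, p, hp, rfl⟩
  exact Submodule.smul_mem _ _ (Submodule.subset_span hp)

theorem IsPredictionSet.add_mem_predCone {μ : Measure Ω} {P : Set (Ω → ℝ)}
    (hP : IsPredictionSet μ P) {f g : Ω → ℝ} (hf : f ∈ predCone P) (hg : g ∈ predCone P) :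
    f + g ∈ predCone P := by
  obtain ⟨a, ha, p, hp, rfl⟩ := hf
  obtain ⟨b, hb, r, hr, rfl⟩ := hg
  have hab : 0 < a + b := add_pos ha hb
  refine ⟨a + b, hab, (a / (a + b)) • p + (b / (a + b)) • r,
    hP.1 hp hr (by positivity) (by positivity) (by field_simp), ?_⟩
  rw [smul_add, smul_smul, smul_smul, mul_div_cancel₀ _ hab.ne', mul_div_cancel₀ _ hab.ne']

theorem smul_mem_predCone {P : Set (Ω → ℝ)} {f : Ω → ℝ} (hf : f ∈ predCone P)
    {c : ℝ} (hc : 0 < c) : c • f ∈ predCone P := by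
  obtain ⟨a, ha, p, hp, rfl⟩ := hf
  exact ⟨c * a, mul_pos hc ha, p, hp, smul_smul _ _ _⟩

theorem PIntegrable.integrable_mul {μ : Measure Ω} {P : Set (Ω → ℝ)}
    (hP : IsPredictionSet μ P) {f : Ω → ℝ} (hf : PIntegrable μ P f) {p : Ω → ℝ}
    (hp : p ∈ Submodule.span ℝ P) : Integrable (fun x => f x * p x) μ := by
  induction hp using Submodule.span_induction with
  | mem p hp =>
    refine (hf.2 p hp).mono (hf.1.mul (hP.2 p hp).1).aestronglyMeasurable ?_
    exact .of_forall fun x => by simp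
  | zero => simp
  | add p r _ _ hp hr => simp only [Pi.add_apply, mul_add]; exact hp.add hr
  | smul c p _ hp => simpa [mul_left_comm] using hp.const_mul c

theorem PIntegrable.sub {μ : Measure Ω} {P : Set (Ω → ℝ)} (hP : IsPredictionSet μ P)
    {f g : Ω → ℝ} (hf : PIntegrable μ P f) (hg : PIntegrable μ P g) :
    PIntegrable μ P (f - g) := by
  refine ⟨hf.1.sub hg.1, fun p hp => ?_⟩
  have hp' := Submodule.subset_span (R := ℝ) hp
  refine ((hf.integrable_mul hP hp').sub (hg.integrable_mul hP hp')).norm.congr ?_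
  refine .of_forall fun x => ?_
  simp [← sub_mul, abs_of_nonneg ((hP.2 p hp).2.1 x)]

theorem pairing_add_smul {μ : Measure Ω} {P : Set (Ω → ℝ)} (hP : IsPredictionSet μ P)
    {f : Ω → ℝ} (hf : PIntegrable μ P f) {p r : Ω → ℝ} (hp : p ∈ Submodule.span ℝ P)
    (hr : r ∈ Submodule.span ℝ P) (c : ℝ) :
    pairing μ (p + c • r) f = pairing μ p f + c * pairing μ r f := by
  unfold pairing
  rw [← integral_const_mul, ← integral_add (hf.integrable_mul hP hp)
    ((hf.integrable_mul hP hr).const_mul c)]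
  congr 1 with x
  simp only [Pi.add_apply, Pi.smul_apply, smul_eq_mul]
  ring

theorem pairing_sub {μ : Measure Ω} {P : Set (Ω → ℝ)} (hP : IsPredictionSet μ P)
    {f g : Ω → ℝ} (hf : PIntegrable μ P f) (hg : PIntegrable μ P g) {p : Ω → ℝ}
    (hp : p ∈ Submodule.span ℝ P) :
    pairing μ p (f - g) = pairing μ p f - pairing μ p g := by
  unfold pairing
  rw [← integral_sub (hf.integrable_mul hP hp) (hg.integrable_mul hP hp)]
  simp only [Pi.sub_apply, sub_mul]

theorem rderiv_le {μ : Measure Ω} {P : Set (Ω → ℝ)} (hP : IsPredictionSet μ P)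
    {Φ : (Ω → ℝ) → ℝ} (hΦ : SublinearOn (predCone P) Φ) {q p : Ω → ℝ}
    (hq : q ∈ predCone P) (hp : p ∈ predCone P) : rderiv P Φ q p ≤ (Φ p : EReal) := by
  have hmem : q + (1 : ℝ) • p ∈ predCone P := by
    simpa using hP.add_mem_predCone hq hp
  refine (iInf_le _ ⟨1, one_pos, hmem⟩).trans (EReal.coe_le_coe_iff.2 ?_)
  have := hΦ.2 q hq p hp
  simp only [one_smul, div_one]
  linarith

theorem rderiv_self {P : Set (Ω → ℝ)} {Φ : (Ω → ℝ) → ℝ}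
    (hΦ : SublinearOn (predCone P) Φ) {q : Ω → ℝ} (hq : q ∈ predCone P) :
    rderiv P Φ q q = (Φ q : EReal) := by
  have hadd (t : ℝ) : q + t • q = (1 + t) • q := by rw [add_smul, one_smul]
  have hmem : q + (1 : ℝ) • q ∈ predCone P := by
    rw [hadd]
    exact smul_mem_predCone hq (by norm_num)
  have : Nonempty {t : ℝ // 0 < t ∧ q + t • q ∈ predCone P} := ⟨⟨1, one_pos, hmem⟩⟩
  have hslope (t : {t : ℝ // 0 < t ∧ q + t • q ∈ predCone P}) :
      (Φ (q + (t : ℝ) • q) - Φ q) / (t : ℝ) = Φ q := by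
    have ht := t.2.1
    rw [hadd, hΦ.1 q hq _ (by linarith)]
    field_simp
    ring
  simp only [rderiv, hslope, iInf_const]

theorem pairing_le_rderiv {μ : Measure Ω} {P : Set (Ω → ℝ)} (hP : IsPredictionSet μ P)
    {Φ : (Ω → ℝ) → ℝ} {q p h : Ω → ℝ} (hh : PIntegrable μ P h) (hq : q ∈ predCone P)
    (hp : p ∈ predCone P) (hle : ∀ r ∈ predCone P, pairing μ r h ≤ Φ r)
    (heq : pairing μ q h = Φ q) : (pairing μ p h : EReal) ≤ rderiv P Φ q p := by
  refine le_iInf fun t => EReal.coe_le_coe_iff.2 ?_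
  have hsub := hle _ t.2.2
  rw [pairing_add_smul hP hh (predCone_subset_span P hq) (predCone_subset_span P hp), heq] at hsub
  rw [le_div_iff₀ t.2.1]
  linarith

/-- Suppose `𝒪(q)` has a trivial annihilator in `ℒ(𝒫)`. If
`g ∈ ℒ(𝒫)` satisfies `p·g = Φ′₊(p,q)` for all `p ∈ 𝒫⁺`, then `g` is the unique
`𝒫`-integrable subgradient of `Φ` at `q` (unique up to `μ`-a.e. equality). -/
theorem unique_PIntegrable_subgradient
    (μ : Measure Ω) (P : Set (Ω → ℝ)) (hP : IsPredictionSet μ P)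
    (Φ : (Ω → ℝ) → ℝ) (hΦ : SublinearOn (predCone P) Φ)
    (q : Ω → ℝ) (hq : q ∈ predCone P)
    (hann : ∀ f : Ω → ℝ, PIntegrable μ P f →
      (∀ p ∈ oSet P q, pairing μ p f = 0) → f =ᵐ[μ] 0)
    (g : Ω → ℝ) (hg : PIntegrable μ P g)
    (hgrad : ∀ p ∈ predCone P, ((pairing μ p g : ℝ) : EReal) = rderiv P Φ q p) :
    ((∀ p ∈ predCone P, pairing μ p g ≤ Φ p) ∧ pairing μ q g = Φ q) ∧
    ∀ h : Ω → ℝ, PIntegrable μ P h →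
      (∀ p ∈ predCone P, pairing μ p h ≤ Φ p) → pairing μ q h = Φ q →
      h =ᵐ[μ] g := by
  refine ⟨⟨fun p hp => ?_, ?_⟩, fun h hh hle heq => ?_⟩
  · exact EReal.coe_le_coe_iff.1 ((hgrad p hp).trans_le (rderiv_le hP hΦ hq hp))
  · exact EReal.coe_eq_coe_iff.1 ((hgrad q hq).trans (rderiv_self hΦ hq))
  have hgq : pairing μ q g = Φ q :=
    EReal.coe_eq_coe_iff.1 ((hgrad q hq).trans (rderiv_self hΦ hq))
  have hq' := predCone_subset_span P hq
  have hdir : ∀ p ∈ dirSet P q, pairing μ p h ≤ pairing μ p g := by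
    rintro p ⟨hp, ε, hε, hmem⟩
    have hcone := EReal.coe_le_coe_iff.1
      ((pairing_le_rderiv hP hh hq hmem hle heq).trans_eq (hgrad _ hmem).symm)
    rw [pairing_add_smul hP hh hq' hp, pairing_add_smul hP hg hq' hp, heq, hgq] at hcone
    exact le_of_mul_le_mul_left (le_of_add_le_add_left hcone) hε
  have hzero : h - g =ᵐ[μ] 0 := by
    refine hann _ (hh.sub hP hg) fun p hp => ?_
    have hneg := hdir _ hp.2
    simp only [pairing, Pi.neg_apply, mul_neg, integral_neg] at hneg
    rw [pairing_sub hP hh hg hp.1.1]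
    exact sub_eq_zero.2 (le_antisymm (hdir p hp.1) (neg_le_neg_iff.1 hneg))
  exact sub_ae_eq_zero h g |>.1 hzero
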